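/- Let A be a unital complex Banach algebra and β : A → A a continuous unital algebra homomorphism with β ∘ β = β. Set J = ker β, J̃ = ℂ·1 + J (the unitization of J, a closed unital subalgebra of A), and B = ran β (a closed unital subalgebra of A, isomorphic to A/J). Suppose the elements of B that are invertible within B are dense in B (i.e. tsr(A/J) = 1). Then rtsr(J̃) = rtsr(A): for every n ≥ 1, Rg_n(A) is dense in A^n if and only if Rg_n(J̃) is dense in J̃^n. -/

import Mathlib

/-- `RgDenseIn S n` says that the set `Rg_n(S)` of right-invertible `n`-tuples
with entries in the (unital, closed) subalgebra `S ⊆ A` is dense in `S^n`. -/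
def RgDenseIn {A : Type*} [NormedRing A] (S : Set A) (n : ℕ) : Prop :=
  ∀ a : Fin n → A, (∀ i, a i ∈ S) → ∀ ε : ℝ, 0 < ε →
    ∃ b c : Fin n → A, (∀ i, b i ∈ S) ∧ (∀ i, c i ∈ S) ∧
      (∀ i, ‖a i - b i‖ < ε) ∧ ∑ i, b i * c i = 1

open Filter Topology

lemma RgDenseIn.exists_mem_nhds {A : Type*} [NormedRing A] {S : Set A} {n : ℕ}
    (h : RgDenseIn S n) {a : Fin n → A} (ha : ∀ i, a i ∈ S) {U : Fin n → Set A}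
    (hU : ∀ i, U i ∈ 𝓝 (a i)) :
    ∃ b c : Fin n → A, (∀ i, b i ∈ S) ∧ (∀ i, c i ∈ S) ∧ (∀ i, b i ∈ U i) ∧
      ∑ i, b i * c i = 1 := by
  have key : ∀ᶠ ε : ℝ in 𝓝[>] 0, ∀ i, Metric.ball (a i) ε ⊆ U i := by
    refine eventually_all.2 fun i => ?_
    obtain ⟨r, hr, hrU⟩ := Metric.mem_nhds_iff.1 (hU i)
    filter_upwards [Ioo_mem_nhdsGT hr] with ε hε
    exact (Metric.ball_subset_ball hε.2.le).trans hrU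
  obtain ⟨ε, hε, hpos⟩ := (key.and self_mem_nhdsWithin).exists
  obtain ⟨b, c, hb, hc, hab, hbc⟩ := h a ha ε hpos
  refine ⟨b, c, hb, hc, fun i => hε i ?_, hbc⟩
  rw [Metric.mem_ball', dist_eq_norm]
  exact hab i

lemma mem_unitization_ker_iff {A : Type*} [NormedRing A] [NormedAlgebra ℂ A] (β : A →ₐ[ℂ] A)
    (a : A) :
    a ∈ {a : A | ∃ (z : ℂ) (j : A), β j = 0 ∧ a = algebraMap ℂ A z + j} ↔
      ∃ z : ℂ, β a = algebraMap ℂ A z := by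
  constructor
  · rintro ⟨z, j, hj, rfl⟩
    exact ⟨z, by simp [hj]⟩
  · rintro ⟨z, hz⟩
    exact ⟨z, a - algebraMap ℂ A z, by simp [hz], by simp⟩

/-- If a row `b` is right invertible in `A` and its image under `β` is a nonzero row of scalars,
then `b` has a right inverse whose image under `β` is also scalar. -/
lemma exists_right_inverse_of_map_eq_algebraMap {A ι : Type*} [NormedRing A] [NormedAlgebra ℂ A]
    [Fintype ι] (β : A →ₐ[ℂ] A) (hβ2 : ∀ a, β (β a) = β a)
    {b c : ι → A} {z : ι → ℂ} (hb : ∀ i, β (b i) = algebraMap ℂ A (z i)) {i₀ : ι}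
    (hz : z i₀ ≠ 0) (hbc : ∑ i, b i * c i = 1) :
    ∃ c' : ι → A, (∀ i, ∃ t : ℂ, β (c' i) = algebraMap ℂ A t) ∧ ∑ i, b i * c' i = 1 := by
  classical
  let e : ι → ℂ := Pi.single i₀ (z i₀)⁻¹
  let w : ι → A := fun i => algebraMap ℂ A (e i) - β (c i)
  have hw : ∀ i, β (w i) = w i := fun i => by simp [w, hβ2]
  have he : ∑ i, z i * e i = 1 := by
    rw [Finset.sum_eq_single i₀]
    · simp [e, hz]
    · intro j _ hj
      simp [e, hj]
    · simp
  have hβw : β (∑ j, b j * w j) = 0 := by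
    have h1 : ∑ i, β (b i) * β (c i) = 1 := by
      simpa using congrArg β hbc
    have h2 : ∑ i, β (b i) * algebraMap ℂ A (e i) = 1 := by
      simp_rw [hb, ← map_mul, ← map_sum, he, map_one]
    simp only [map_sum, map_mul, hw]
    simp only [w, mul_sub, Finset.sum_sub_distrib, h1, h2, sub_self]
  refine ⟨fun i => c i + w i - c i * ∑ j, b j * w j, fun i => ⟨e i, ?_⟩, ?_⟩
  · rw [map_sub, map_mul, hβw, map_add, hw]
    simp [w]
  · simp only [mul_sub, mul_add, Finset.sum_sub_distrib, Finset.sum_add_distrib, ← mul_assoc]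
    rw [← Finset.sum_mul, hbc]
    simp

/-- Elements of `A` near a point with scalar image `z ≠ 0` can be right-multiplied by a unit
into elements with image `z`, without moving far from that point. -/
lemma eventually_exists_mul_unit_mem {A : Type*} [NormedRing A] [NormedAlgebra ℂ A]
    [CompleteSpace A] (β : A →ₐ[ℂ] A) (hβc : Continuous β) (hβ2 : ∀ a, β (β a) = β a)
    {a : A} {z : ℂ} (hz : z ≠ 0) (ha : β a = algebraMap ℂ A z) {U : Set A} (hU : U ∈ 𝓝 a) :
    ∀ᶠ x in 𝓝 a, ∃ v : Aˣ, β (x * v) = algebraMap ℂ A z ∧ x * v ∈ U := by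
  have hu : IsUnit (β a) := ha ▸ hz.isUnit.map (algebraMap ℂ A)
  obtain ⟨u, hu⟩ := hu
  have hinv : ContinuousAt (fun x => Ring.inverse (β x)) a :=
    ContinuousAt.comp (g := Ring.inverse) (hu ▸ NormedRing.inverse_continuousAt u)
      hβc.continuousAt
  have hcont : ContinuousAt (fun x => x * (Ring.inverse (β x) * algebraMap ℂ A z)) a :=
    continuousAt_id.mul (hinv.mul continuousAt_const)
  have hval : a * (Ring.inverse (β a) * algebraMap ℂ A z) = a := by
    rw [← ha, Ring.inverse_mul_cancel _ ⟨u, hu⟩, mul_one]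
  have hunit : ∀ᶠ x in 𝓝 a, IsUnit (β x) :=
    hβc.continuousAt.eventually (hu ▸ u.nhds)
  have hmem := hcont.eventually_mem (s := U) (by rwa [hval])
  filter_upwards [hunit, hmem] with x hx hxU
  obtain ⟨y, hy⟩ := hx
  obtain ⟨t, ht⟩ := hz.isUnit.map (algebraMap ℂ A)
  rw [← hy, Ring.inverse_unit, ← ht] at hxU
  refine ⟨y⁻¹ * t, ?_, by simpa using hxU⟩
  have h1 : β x * β (↑y⁻¹ : A) = 1 := by
    rw [← hβ2 x, ← map_mul, ← hy, Units.mul_inv, map_one]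
  rw [Units.val_mul, map_mul, map_mul, ← mul_assoc, h1, ht]
  simp

/-- **Theorem (split exact sequences, part (ii)).**  Let `β : A → A` be a
continuous idempotent unital algebra endomorphism of a unital complex Banach
algebra `A`, with `J = ker β`, `J̃ = ℂ·1 + J` and `B = ran β ≅ A/J`.  If the
invertibles of `B` are dense in `B` (`tsr(A/J) = 1`), then
`rtsr(J̃) = rtsr(A)`: for every `n ≥ 1`, `Rg_n(A)` is dense in `A^n` iff
`Rg_n(J̃)` is dense in `J̃^n`. -/
theorem rtsr_unitization_ker_eq_of_split_tsr_one
    {A : Type*} [NormedRing A] [NormedAlgebra ℂ A] [CompleteSpace A]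
    (β : A →ₐ[ℂ] A) (hβc : Continuous β) (hβ2 : ∀ a, β (β a) = β a)
    (hBinv : ∀ b ∈ Set.range β, ∀ ε : ℝ, 0 < ε →
      ∃ u u' : A, u ∈ Set.range β ∧ u' ∈ Set.range β ∧
        u * u' = 1 ∧ u' * u = 1 ∧ ‖b - u‖ < ε)
    (n : ℕ) (hn : 1 ≤ n) :
    RgDenseIn (Set.univ : Set A) n ↔
      RgDenseIn {a : A | ∃ (z : ℂ) (j : A), β j = 0 ∧ a = algebraMap ℂ A z + j} n := by
  constructor
  · intro h a ha ε hε
    simp only [mem_unitization_ker_iff] at ha ⊢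
    choose z hz using ha
    have hsmall : ∀ᶠ s : ℂ in 𝓝 0, ‖algebraMap ℂ A s‖ < ε / 2 := by
      have : Continuous fun s : ℂ => ‖algebraMap ℂ A s‖ := (continuous_algebraMap ℂ A).norm
      exact this.continuousAt.eventually_lt continuousAt_const (by simpa using hε)
    have hne : ∀ i, ∃ s : ℂ, ‖algebraMap ℂ A s‖ < ε / 2 ∧ z i + s ≠ 0 := fun i => by
      by_cases hzi : z i = 0
      · obtain ⟨s, hs, hs0⟩ :=
          ((hsmall.filter_mono nhdsWithin_le_nhds).and
            (self_mem_nhdsWithin : {(0 : ℂ)}ᶜ ∈ 𝓝[≠] 0)).exists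
        exact ⟨s, hs, by simpa [hzi] using hs0⟩
      · exact ⟨0, by simpa using hε, by simpa using hzi⟩
    choose s hs hs0 using hne
    have ha' : ∀ i, β (a i + algebraMap ℂ A (s i)) = algebraMap ℂ A (z i + s i) := fun i => by
      simp [hz]
    obtain ⟨x, y, -, -, hx, hxy⟩ := h.exists_mem_nhds (fun i => Set.mem_univ _) fun i =>
      eventually_exists_mul_unit_mem β hβc hβ2 (hs0 i) (ha' i)
        (Metric.ball_mem_nhds _ (half_pos hε))
    choose v hv hvU using hx
    obtain ⟨c, hc, hbc⟩ := exists_right_inverse_of_map_eq_algebraMap β hβ2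
      (c := fun i => ↑(v i)⁻¹ * y i) hv (hs0 ⟨0, hn⟩) (by simpa [mul_assoc] using hxy)
    refine ⟨fun i => x i * v i, c, fun i => ⟨_, hv i⟩, hc, fun i => ?_, hbc⟩
    have h1 := hvU i
    rw [Metric.mem_ball', dist_eq_norm] at h1
    calc ‖a i - x i * v i‖
        = ‖(a i + algebraMap ℂ A (s i) - x i * v i) - algebraMap ℂ A (s i)‖ := by
          congr 1; abel
      _ ≤ _ := norm_sub_le _ _
      _ < ε := by linarith [hs i]
  · intro h a _ ε hε
    choose u u' hu hu' huu' hu'u hau using fun i => hBinv (β (a i)) ⟨a i, rfl⟩ (ε / 2) (half_pos hε)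
    have hk : ∀ i, 1 + (a i - β (a i)) * u' i ∈
        {a : A | ∃ (z : ℂ) (j : A), β j = 0 ∧ a = algebraMap ℂ A z + j} := fun i =>
      ⟨1, (a i - β (a i)) * u' i, by simp [hβ2], by simp⟩
    have hmul : ∀ i, (1 + (a i - β (a i)) * u' i) * u i = u i + (a i - β (a i)) := fun i => by
      rw [add_mul, mul_assoc, hu'u, one_mul, mul_one]
    obtain ⟨b, c, -, -, hbU, hbc⟩ := h.exists_mem_nhds hk fun i =>
      (continuous_mul_const (u i)).continuousAt.preimage_mem_nhds
        (Metric.ball_mem_nhds _ (half_pos hε))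
    refine ⟨fun i => b i * u i, fun i => u' i * c i, fun _ => Set.mem_univ _,
      fun _ => Set.mem_univ _, fun i => ?_, ?_⟩
    · have h1 := hbU i
      rw [Set.mem_preimage, Metric.mem_ball', dist_eq_norm, hmul] at h1
      calc ‖a i - b i * u i‖
          = ‖(u i + (a i - β (a i)) - b i * u i) + (β (a i) - u i)‖ := by congr 1; abel
        _ ≤ _ := norm_add_le _ _
        _ < ε := by linarith [hau i]
    · rw [← hbc]
      refine Finset.sum_congr rfl fun i _ => ?_
      rw [mul_assoc, ← mul_assoc (u i), huu', one_mul]
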